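/- arXiv:2203.08136 — 4 statements merged into one kernel-verified Lean document; each statement's English description precedes it below -/
import Mathlib

section
/- Let G be a finite simple graph in which every vertex has degree at least 3 and in which no two distinct triangles share an edge. Then twice the number of edges of G contained in no triangle is at least the number of vertices of G of degree exactly 3. -/
open Classical in
/-- If distinct triangles share no edge, an edge has at most one common neighbour of its ends. -/
theorem SimpleGraph.eq_of_adj_of_triangles_inter_card_le_one {V : Type*} [Fintype V]
    (G : SimpleGraph V)
    (h : ∀ t₁ ∈ G.cliqueFinset 3, ∀ t₂ ∈ G.cliqueFinset 3, t₁ ≠ t₂ → (t₁ ∩ t₂).card ≤ 1)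
    {v w a b : V} (hvw : G.Adj v w) (hva : G.Adj v a) (hwa : G.Adj w a)
    (hvb : G.Adj v b) (hwb : G.Adj w b) : a = b := by
  by_contra hab
  have h₁ : ({v, w, a} : Finset V) ∈ G.cliqueFinset 3 := by
    rw [SimpleGraph.mem_cliqueFinset_iff, SimpleGraph.is3Clique_triple_iff]
    exact ⟨hvw, hva, hwa⟩
  have h₂ : ({v, w, b} : Finset V) ∈ G.cliqueFinset 3 := by
    rw [SimpleGraph.mem_cliqueFinset_iff, SimpleGraph.is3Clique_triple_iff]
    exact ⟨hvw, hvb, hwb⟩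
  have hne : ({v, w, a} : Finset V) ≠ {v, w, b} := by
    intro heq
    have ha : a ∈ ({v, w, b} : Finset V) := heq ▸ by simp
    simp only [Finset.mem_insert, Finset.mem_singleton] at ha
    rcases ha with rfl | rfl | rfl
    · exact hva.ne rfl
    · exact hwa.ne rfl
    · exact hab rfl
  have hsub : ({v, w} : Finset V) ⊆ {v, w, a} ∩ {v, w, b} := by
    intro x
    simp only [Finset.mem_insert, Finset.mem_singleton, Finset.mem_inter]
    tauto
  have hcard := Finset.card_le_card hsub
  rw [Finset.card_pair hvw.ne] at hcard
  have := h _ h₁ _ h₂ hne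
  omega

open Classical in
/-- If distinct triangles share no edge, a vertex of degree 3 has an incident edge
contained in no triangle. -/
theorem SimpleGraph.exists_adj_not_mem_triangle_of_degree_eq_three {V : Type*} [Fintype V]
    (G : SimpleGraph V)
    (h : ∀ t₁ ∈ G.cliqueFinset 3, ∀ t₂ ∈ G.cliqueFinset 3, t₁ ≠ t₂ → (t₁ ∩ t₂).card ≤ 1)
    {v : V} (hv : G.degree v = 3) :
    ∃ w, G.Adj v w ∧ ¬ ∃ t ∈ G.cliqueFinset 3, ∀ u ∈ s(v, w), u ∈ t := by
  by_contra! hcon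
  have hpartner : ∀ w, G.Adj v w → ∃ u, G.Adj v u ∧ G.Adj w u := by
    intro w hw
    obtain ⟨t, ht, hmem⟩ := hcon w hw
    rw [SimpleGraph.mem_cliqueFinset_iff] at ht
    have hvt : v ∈ t := hmem v (Sym2.mem_mk_left v w)
    have hwt : w ∈ t := hmem w (Sym2.mem_mk_right v w)
    obtain ⟨u, hu, hnot⟩ : ∃ u ∈ t, u ∉ ({v, w} : Finset V) :=
      Finset.exists_mem_notMem_of_card_lt_card
        (by rw [Finset.card_pair hw.ne, ht.card_eq]; norm_num)
    simp only [Finset.mem_insert, Finset.mem_singleton, not_or] at hnot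
    exact ⟨u, ht.isClique hvt hu (Ne.symm hnot.1), ht.isClique hwt hu (Ne.symm hnot.2)⟩
  rw [← SimpleGraph.card_neighborFinset_eq_degree] at hv
  obtain ⟨x, y, z, hxy, hxz, hyz, hN⟩ := Finset.card_eq_three.1 hv
  have hadj : ∀ w, G.Adj v w ↔ w = x ∨ w = y ∨ w = z := by
    intro w
    rw [← SimpleGraph.mem_neighborFinset, hN]
    simp
  have huniq := fun {w a b : V} =>
    G.eq_of_adj_of_triangles_inter_card_le_one h (v := v) (w := w) (a := a) (b := b)
  have hsymm : ∀ a b, G.Adj a b → G.Adj b a := fun _ _ hab => hab.symm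
  have hirr : ∀ a, ¬ G.Adj a a := fun a => G.irrefl
  obtain ⟨a, hva, hxa⟩ := hpartner x ((hadj x).2 (by simp))
  obtain ⟨b, hvb, hyb⟩ := hpartner y ((hadj y).2 (by simp))
  obtain ⟨c, hvc, hzc⟩ := hpartner z ((hadj z).2 (by simp))
  grind

open Classical in
/-- In a finite simple graph of minimum degree at least 3 in which no two distinct
triangles share an edge, twice the number of edges contained in no triangle is at
least the number of vertices of degree exactly 3. -/
theorem stmt_2 {V : Type*} [Fintype V] (G : SimpleGraph V)
    (hdeg : ∀ v : V, 3 ≤ G.degree v)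
    (h : ∀ t₁ ∈ G.cliqueFinset 3, ∀ t₂ ∈ G.cliqueFinset 3, t₁ ≠ t₂ → (t₁ ∩ t₂).card ≤ 1) :
    (Finset.univ.filter (fun v : V => G.degree v = 3)).card ≤
      2 * (G.edgeFinset.filter (fun e => ¬ ∃ t ∈ G.cliqueFinset 3, ∀ v ∈ e, v ∈ t)).card := by
  have hex : ∀ v, ∃ w, G.degree v = 3 →
      G.Adj v w ∧ ¬ ∃ t ∈ G.cliqueFinset 3, ∀ u ∈ s(v, w), u ∈ t := by
    intro v
    by_cases hv : G.degree v = 3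
    · obtain ⟨w, hw⟩ := G.exists_adj_not_mem_triangle_of_degree_eq_three h hv
      exact ⟨w, fun _ => hw⟩
    · exact ⟨v, fun hv' => absurd hv' hv⟩
  choose f hf using hex
  refine Finset.card_le_mul_card_image_of_maps_to (f := fun v => s(v, f v)) ?_ 2 ?_
  · intro v hv
    obtain ⟨hadj, hnot⟩ := hf v (Finset.mem_filter.1 hv).2
    exact Finset.mem_filter.2 ⟨SimpleGraph.mem_edgeFinset.2 hadj, hnot⟩
  · intro e _
    calc _ ≤ e.toFinset.card := by
          refine Finset.card_le_card fun v hv => ?_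
          rw [Sym2.mem_toFinset, ← (Finset.mem_filter.1 hv).2]
          exact Sym2.mem_mk_left v (f v)
      _ ≤ 2 := by
          rw [Sym2.card_toFinset]
          split_ifs <;> norm_num
end

section
/- Let G be a finite simple graph with n vertices and e edges in which every vertex has degree at least 3 and in which no two distinct triangles share an edge. Then three times the number of triangles of G is at most 2e - 2n. -/
open Classical in
/-- If distinct triangles share at most one vertex, the triangles through `v` use up disjoint pairs
of neighbours of `v`. -/
theorem two_mul_card_triangles_through_le_degree {V : Type*} [Fintype V] (G : SimpleGraph V)
    (h : ∀ t₁ ∈ G.cliqueFinset 3, ∀ t₂ ∈ G.cliqueFinset 3, t₁ ≠ t₂ → (t₁ ∩ t₂).card ≤ 1) (v : V) :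
    2 * ((G.cliqueFinset 3).filter (v ∈ ·)).card ≤ G.degree v := by
  set S := (G.cliqueFinset 3).filter (v ∈ ·)
  have hS : ∀ t ∈ S, G.IsNClique 3 t ∧ v ∈ t := fun t ht => by
    simpa [S, SimpleGraph.mem_cliqueFinset_iff] using ht
  have hdisj : (S : Set (Finset V)).PairwiseDisjoint (fun t => t.erase v) := by
    intro t₁ h₁ t₂ h₂ hne
    refine Finset.disjoint_left.2 fun w hw₁ hw₂ => ?_
    rw [Finset.mem_erase] at hw₁ hw₂
    have hcard := h t₁ (Finset.mem_filter.1 h₁).1 t₂ (Finset.mem_filter.1 h₂).1 hne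
    exact hw₁.1 (Finset.card_le_one.1 hcard w (Finset.mem_inter.2 ⟨hw₁.2, hw₂.2⟩) v
      (Finset.mem_inter.2 ⟨(hS t₁ h₁).2, (hS t₂ h₂).2⟩))
  have hcard : (S.biUnion fun t => t.erase v).card = 2 * S.card := by
    rw [Finset.card_biUnion hdisj, Finset.sum_const_nat (m := 2), mul_comm]
    intro t ht
    rw [Finset.card_erase_of_mem (hS t ht).2, (hS t ht).1.card_eq]
  rw [← hcard, ← G.card_neighborFinset_eq_degree]
  refine Finset.card_le_card fun w hw => ?_
  obtain ⟨t, ht, hwt⟩ := Finset.mem_biUnion.1 hw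
  rw [Finset.mem_erase] at hwt
  rw [SimpleGraph.mem_neighborFinset]
  exact (hS t ht).1.isClique (hS t ht).2 hwt.2 hwt.1.symm

open Classical in
/-- Counting incidences between vertices and triangles. -/
theorem sum_card_triangles_through {V : Type*} [Fintype V] (G : SimpleGraph V) :
    ∑ v, ((G.cliqueFinset 3).filter (v ∈ ·)).card = 3 * (G.cliqueFinset 3).card := by
  have key := Finset.sum_card_bipartiteAbove_eq_sum_card_bipartiteBelow (s := Finset.univ)
    (t := G.cliqueFinset 3) (fun (v : V) (t : Finset V) => v ∈ t)
  simp only [Finset.bipartiteAbove, Finset.bipartiteBelow, Finset.filter_univ_mem] at key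
  rw [key, Finset.sum_const_nat (m := 3), mul_comm]
  exact fun t ht => (G.mem_cliqueFinset_iff.1 ht).card_eq

open Classical in
/-- In a finite simple graph with `n` vertices and `e` edges, of minimum degree at least 3,
in which no two distinct triangles share an edge, three times the number of triangles is
at most `2e - 2n`. -/
theorem stmt_3 {V : Type*} [Fintype V] (G : SimpleGraph V)
    (hdeg : ∀ v : V, 3 ≤ G.degree v)
    (h : ∀ t₁ ∈ G.cliqueFinset 3, ∀ t₂ ∈ G.cliqueFinset 3, t₁ ≠ t₂ → (t₁ ∩ t₂).card ≤ 1) :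
    3 * ((G.cliqueFinset 3).card : ℤ) ≤
      2 * (G.edgeFinset.card : ℤ) - 2 * (Fintype.card V : ℤ) := by
  have hsum : ∑ v, (((G.cliqueFinset 3).filter (v ∈ ·)).card + 2) ≤ ∑ v, G.degree v :=
    Finset.sum_le_sum fun v _ => by
      have h₁ := two_mul_card_triangles_through_le_degree G h v
      have h₂ := hdeg v
      omega
  rw [Finset.sum_add_distrib, sum_card_triangles_through, G.sum_degrees_eq_twice_card_edges,
    Finset.sum_const, Finset.card_univ, smul_eq_mul] at hsum
  omega
end

section
/- If G is a 4-critical finite simple graph with n vertices and e edges, then 3e ≥ 5n - 2. -/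
/-- A graph is 4-critical if its chromatic number equals 4 and every proper subgraph
has chromatic number at most 3. -/
def IsFourCritical {V : Type*} (G : SimpleGraph V) : Prop :=
  G.chromaticNumber = 4 ∧ ∀ H : G.Subgraph, H ≠ ⊤ → H.coe.chromaticNumber ≤ 3

namespace FourCritical

universe u

open Finset
open scoped Classical

variable {V : Type u}

/-- `S` induces a 3-colorable subgraph of `G`. -/
def ColorableOn (G : SimpleGraph V) (S : Finset V) : Prop :=
  ∃ c : V → Fin 3, ∀ a ∈ S, ∀ b ∈ S, G.Adj a b → c a ≠ c b

/-- The number of adjacent pairs in `S × T`. -/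
noncomputable def adjCount (G : SimpleGraph V) (S T : Finset V) : ℤ :=
  ∑ a ∈ S, ∑ b ∈ T, if G.Adj a b then 1 else 0

/-- Twice the Kostochka–Yancey potential `5|S| - 3|E(G[S])|`. -/
noncomputable def potential (G : SimpleGraph V) (S : Finset V) : ℤ :=
  10 * (S.card : ℤ) - 3 * adjCount G S S

/-- A vertex-critical non-3-colorable graph of large potential, all of whose smaller
competitors contain a non-3-colorable vertex set of small potential. -/
structure MinimalCounterexample [Fintype V] (G : SimpleGraph V) : Prop where
  not_colorable : ¬ ColorableOn G univ
  colorable : ∀ S : Finset V, S ≠ univ → ColorableOn G S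
  lt_potential : 4 < potential G univ
  exists_of_card_lt : ∀ (U : Type u) (H : SimpleGraph U) (T : Finset U),
    T.card < Fintype.card V → ¬ ColorableOn H T →
      ∃ W ⊆ T, ¬ ColorableOn H W ∧ potential H W ≤ 4

section Counting

variable (G : SimpleGraph V)

lemma ColorableOn.mono {G H : SimpleGraph V} {S T : Finset V} (hGH : G ≤ H) (hST : S ⊆ T)
    (h : ColorableOn H T) : ColorableOn G S := by
  obtain ⟨c, hc⟩ := h
  exact ⟨c, fun a ha b hb hab => hc a (hST ha) b (hST hb) (hGH hab)⟩

lemma two_le_card_of_not_colorableOn {G : SimpleGraph V} {S : Finset V}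
    (h : ¬ ColorableOn G S) : 2 ≤ S.card := by
  by_contra! hS
  refine h ⟨fun _ => 0, fun a ha b hb hab => ?_⟩
  have := Finset.card_le_one.1 (by omega : S.card ≤ 1) a ha b hb
  exact absurd this hab.ne

/-- A coloring of the vertices satisfying `P` other than `y` extends to `y`. -/
lemma update_color_ne {G : SimpleGraph V} {P : V → Prop} {y : V} {c : V → Fin 3} {i : Fin 3}
    (hc : ∀ a, P a → a ≠ y → ∀ b, P b → b ≠ y → G.Adj a b → c a ≠ c b)
    (hi : ∀ w, P w → G.Adj y w → c w ≠ i) (a : V) (ha : P a) (b : V) (hb : P b)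
    (hab : G.Adj a b) : Function.update c y i a ≠ Function.update c y i b := by
  by_cases hay : a = y <;> by_cases hby : b = y
  · exact absurd (hay.trans hby.symm) hab.ne
  · subst hay
    simpa [hby] using (hi b hb hab).symm
  · subst hby
    simpa [hay] using hi a ha hab.symm
  · simpa [hay, hby] using hc a ha hay b hb hby hab

lemma adjCount_comm (S T : Finset V) : adjCount G S T = adjCount G T S := by
  simp only [adjCount]
  rw [Finset.sum_comm]
  simp only [G.adj_comm]

lemma adjCount_union_left {S S' : Finset V} (h : Disjoint S S') (T : Finset V) :
    adjCount G (S ∪ S') T = adjCount G S T + adjCount G S' T :=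
  Finset.sum_union h

lemma adjCount_union_right {T T' : Finset V} (S : Finset V) (h : Disjoint T T') :
    adjCount G S (T ∪ T') = adjCount G S T + adjCount G S T' := by
  rw [adjCount_comm, adjCount_union_left G h, adjCount_comm G T, adjCount_comm G T']

lemma adjCount_nonneg (S T : Finset V) : 0 ≤ adjCount G S T :=
  Finset.sum_nonneg fun _ _ => Finset.sum_nonneg fun _ _ => by split_ifs <;> simp

lemma one_le_adjCount {S T : Finset V} {a b : V} (ha : a ∈ S) (hb : b ∈ T) (hab : G.Adj a b) :
    1 ≤ adjCount G S T := by
  calc (1 : ℤ) = if G.Adj a b then 1 else 0 := by simp [hab]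
    _ ≤ ∑ b ∈ T, if G.Adj a b then 1 else 0 :=
      Finset.single_le_sum (f := fun b => if G.Adj a b then (1 : ℤ) else 0)
        (fun _ _ => by split_ifs <;> simp) hb
    _ ≤ adjCount G S T :=
      Finset.single_le_sum (f := fun a => ∑ b ∈ T, if G.Adj a b then (1 : ℤ) else 0)
        (fun _ _ => Finset.sum_nonneg fun _ _ => by split_ifs <;> simp) ha

lemma adjCount_singleton (a : V) (T : Finset V) :
    adjCount G {a} T = ((T.filter (G.Adj a)).card : ℤ) := by
  simp [adjCount]

lemma potential_union {A B : Finset V} (h : Disjoint A B) :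
    potential G (A ∪ B) = potential G A + potential G B - 6 * adjCount G A B := by
  simp only [potential, adjCount_union_left G h, adjCount_union_right G _ h,
    Finset.card_union_of_disjoint h, adjCount_comm G B A]
  push_cast
  ring

lemma potential_insert {a : V} {S : Finset V} (ha : a ∉ S) :
    potential G (insert a S) = potential G S + 10 - 6 * adjCount G {a} S := by
  rw [Finset.insert_eq, potential_union G (by simpa using ha)]
  simp [potential, adjCount, Finset.filter_singleton]
  ring

lemma adjCount_self_le (S : Finset V) :
    adjCount G S S ≤ (S.card : ℤ) * ((S.card : ℤ) - 1) := by
  have key : ∀ a ∈ S, (∑ b ∈ S, if G.Adj a b then (1 : ℤ) else 0) ≤ (S.card : ℤ) - 1 := by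
    intro a ha
    have h1 : (∑ b ∈ S, if G.Adj a b then (1 : ℤ) else 0)
        ≤ ∑ b ∈ S, (1 - if a = b then (1 : ℤ) else 0) := by
      refine Finset.sum_le_sum fun b _ => ?_
      by_cases hab : a = b
      · subst hab; simp
      · simp only [hab, if_false]; split_ifs <;> simp
    simpa [Finset.sum_sub_distrib, ha] using h1
  simpa [adjCount, mul_sub] using Finset.sum_le_sum key

lemma twelve_le_potential {S : Finset V} (h2 : 2 ≤ S.card) (h3 : S.card ≤ 3) :
    12 ≤ potential G S := by
  have := adjCount_self_le G S
  unfold potential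
  obtain h | h : S.card = 2 ∨ S.card = 3 := by omega
  all_goals
    rw [h] at this ⊢
    push_cast at this ⊢
    linarith

/-- Adding one edge lowers the (doubled) potential of a set by at most `6`. -/
lemma potential_le_potential_sup_edge (x y : V) (S : Finset V) :
    potential G S ≤ potential (G ⊔ SimpleGraph.edge x y) S + 6 := by
  have key : adjCount (G ⊔ SimpleGraph.edge x y) S S ≤ adjCount G S S + 2 := by
    have h1 : adjCount (G ⊔ SimpleGraph.edge x y) S S ≤
        ∑ a ∈ S, ∑ b ∈ S, ((if G.Adj a b then (1 : ℤ) else 0) +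
          ((if a = x then 1 else 0) * (if b = y then 1 else 0) +
            (if a = y then 1 else 0) * (if b = x then 1 else 0))) := by
      refine Finset.sum_le_sum fun a _ => Finset.sum_le_sum fun b _ => ?_
      by_cases h : G.Adj a b
      · simp only [SimpleGraph.sup_adj, h, true_or, if_true]
        split_ifs <;> simp
      · simp only [SimpleGraph.sup_adj, h, SimpleGraph.edge_adj]
        split_ifs <;> simp_all
    have h2 : ∀ p q : V,
        ∑ a ∈ S, ∑ b ∈ S, (if a = p then (1 : ℤ) else 0) * (if b = q then 1 else 0) ≤ 1 := by
      intro p q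
      rw [← Finset.sum_mul_sum]
      by_cases hp : p ∈ S <;> by_cases hq : q ∈ S <;> simp [hp, hq]
    simp only [Finset.sum_add_distrib] at h1
    have := h2 x y
    have := h2 y x
    unfold adjCount at h1 ⊢
    linarith
  unfold potential
  linarith

/-- `G` with `u` made adjacent to all neighbors of `v`: the identification of `u` and `v`
once `v` is dropped. -/
def glue (u v : V) : SimpleGraph V :=
  G ⊔ SimpleGraph.fromRel fun a b => a = u ∧ G.Adj v b

lemma potential_insert_le_potential_glue {u v : V} {S : Finset V} (hu : u ∈ S) (hv : v ∉ S) :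
    potential G (insert v S) ≤ potential (glue G u v) S + 10 := by
  have key : adjCount (glue G u v) S S ≤ adjCount G S S + 2 * adjCount G {v} S := by
    have h1 : adjCount (glue G u v) S S ≤
        ∑ a ∈ S, ∑ b ∈ S, ((if G.Adj a b then (1 : ℤ) else 0) +
          ((if a = u then 1 else 0) * (if G.Adj v b then 1 else 0) +
            (if G.Adj v a then 1 else 0) * (if b = u then 1 else 0))) := by
      refine Finset.sum_le_sum fun a _ => Finset.sum_le_sum fun b _ => ?_
      by_cases h : G.Adj a b
      · simp only [glue, SimpleGraph.sup_adj, h, true_or, if_true]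
        split_ifs <;> simp
      · simp only [glue, SimpleGraph.sup_adj, h, SimpleGraph.fromRel_adj]
        split_ifs <;> simp_all
    simp only [Finset.sum_add_distrib, ← Finset.sum_mul_sum, Finset.sum_ite_eq', hu,
      if_true, one_mul, mul_one] at h1
    simp only [adjCount, Finset.sum_singleton] at h1 ⊢
    linarith
  rw [potential_insert G hv]
  unfold potential
  linarith

end Counting

section Collapse

variable (G : SimpleGraph V) (R : Finset V) (φ : V → Fin 3)

/-- Adjacency after collapsing the color classes of `φ` on `R` to the vertices of a triangle. -/
def collapseAdj : V ⊕ Fin 3 → V ⊕ Fin 3 → Prop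
  | .inl a, .inl b => G.Adj a b
  | .inl a, .inr i => ∃ r ∈ R, φ r = i ∧ G.Adj a r
  | .inr i, .inl a => ∃ r ∈ R, φ r = i ∧ G.Adj a r
  | .inr i, .inr j => i ≠ j

/-- The graph obtained from `G` by collapsing the color classes of `φ` on `R` to the vertices
of a triangle. -/
def collapse : SimpleGraph (V ⊕ Fin 3) where
  Adj := collapseAdj G R φ
  symm := ⟨by
    rintro (a | i) (b | j) h
    · exact SimpleGraph.Adj.symm (G := G) h
    · exact h
    · exact h
    · exact Ne.symm h⟩
  loopless := ⟨by
    rintro (a | i) h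
    · exact G.loopless.irrefl a h
    · exact h rfl⟩

@[simp] lemma collapse_adj_inl_inl (a b : V) :
    (collapse G R φ).Adj (.inl a) (.inl b) ↔ G.Adj a b := Iff.rfl

@[simp] lemma collapse_adj_inl_inr (a : V) (i : Fin 3) :
    (collapse G R φ).Adj (.inl a) (.inr i) ↔ ∃ r ∈ R, φ r = i ∧ G.Adj a r := Iff.rfl

@[simp] lemma collapse_adj_inr_inl (a : V) (i : Fin 3) :
    (collapse G R φ).Adj (.inr i) (.inl a) ↔ ∃ r ∈ R, φ r = i ∧ G.Adj a r := Iff.rfl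

@[simp] lemma collapse_adj_inr_inr (i j : Fin 3) :
    (collapse G R φ).Adj (.inr i) (.inr j) ↔ i ≠ j := Iff.rfl

variable {G R φ}

lemma colorableOn_of_collapse [Fintype V]
    (hφ : ∀ a ∈ R, ∀ b ∈ R, G.Adj a b → φ a ≠ φ b)
    (h : ColorableOn (collapse G R φ) (Rᶜ.disjSum univ)) : ColorableOn G univ := by
  obtain ⟨c, hc⟩ := h
  have hinl : ∀ {a}, a ∉ R → Sum.inl a ∈ Rᶜ.disjSum (univ : Finset (Fin 3)) := by simp
  have hinr : ∀ i, Sum.inr i ∈ Rᶜ.disjSum (univ : Finset (Fin 3)) := by simp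
  refine ⟨fun v => if v ∈ R then c (.inr (φ v)) else c (.inl v), fun a _ b _ hab => ?_⟩
  by_cases ha : a ∈ R <;> by_cases hb : b ∈ R <;> simp only [ha, hb, if_true, if_false]
  · exact hc _ (hinr _) _ (hinr _) (hφ a ha b hb hab)
  · exact hc _ (hinr _) _ (hinl hb) ⟨a, ha, rfl, hab.symm⟩
  · exact hc _ (hinl ha) _ (hinr _) ⟨b, hb, rfl, hab⟩
  · exact hc _ (hinl ha) _ (hinl hb) hab

lemma sum_collapse_adj_le (A : Finset V) (X : Finset (Fin 3)) :
    (∑ a ∈ A, ∑ i ∈ X, if ∃ r ∈ R, φ r = i ∧ G.Adj a r then (1 : ℤ) else 0) ≤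
      adjCount G A (R.filter fun r => φ r ∈ X) := by
  refine Finset.sum_le_sum fun a _ => ?_
  rw [← Finset.sum_fiberwise_of_maps_to (s := R.filter fun r => φ r ∈ X) (t := X) (g := φ)
    (fun r hr => (Finset.mem_filter.1 hr).2)]
  refine Finset.sum_le_sum fun i hi => ?_
  have hnonneg : ∀ r ∈ (R.filter fun r => φ r ∈ X).filter (fun r => φ r = i),
      (0 : ℤ) ≤ if G.Adj a r then 1 else 0 := fun _ _ => by split_ifs <;> simp
  split_ifs with h
  · obtain ⟨r, hr, rfl, har⟩ := h
    have := Finset.single_le_sum hnonneg (a := r) (by simp [hr, hi])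
    simpa only [har, if_true] using this
  · exact Finset.sum_nonneg hnonneg

lemma potential_add_le_potential_collapse (A : Finset V) (X : Finset (Fin 3)) :
    potential G A + (10 * X.card - 3 * (X.card * (X.card - 1)))
      - 6 * adjCount G A (R.filter fun r => φ r ∈ X) ≤
      potential (collapse G R φ) (A.disjSum X) := by
  have hX : (∑ i ∈ X, ∑ j ∈ X, if i ≠ j then (1 : ℤ) else 0) = X.card * (X.card - 1) := by
    have : ∀ i ∈ X, (∑ j ∈ X, if i ≠ j then (1 : ℤ) else 0) = X.card - 1 := by
      intro i hi
      have h1 : (∑ j ∈ X, if i ≠ j then (1 : ℤ) else 0) =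
          ∑ j ∈ X, (1 - if i = j then (1 : ℤ) else 0) :=
        Finset.sum_congr rfl fun j _ => by by_cases h : i = j <;> simp [h]
      rw [h1, Finset.sum_sub_distrib, Finset.sum_ite_eq]
      simp [hi]
    rw [Finset.sum_congr rfl this]
    simp only [Finset.sum_const, nsmul_eq_mul]
  have hle := sum_collapse_adj_le (G := G) (R := R) (φ := φ) A X
  have hcomm := Finset.sum_comm (s := X) (t := A)
    (f := fun i a => if ∃ r ∈ R, φ r = i ∧ G.Adj a r then (1 : ℤ) else 0)
  have hcount : adjCount (collapse G R φ) (A.disjSum X) (A.disjSum X) = adjCount G A A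
      + 2 * (∑ a ∈ A, ∑ i ∈ X, if ∃ r ∈ R, φ r = i ∧ G.Adj a r then (1 : ℤ) else 0)
      + X.card * (X.card - 1) := by
    unfold adjCount
    simp only [Finset.sum_disjSum, collapse_adj_inl_inl, collapse_adj_inl_inr,
      collapse_adj_inr_inl, collapse_adj_inr_inr, Finset.sum_add_distrib, hX, hcomm]
    ring
  unfold potential
  rw [hcount, Finset.card_disjSum]
  push_cast
  linarith

end Collapse

namespace MinimalCounterexample

variable [Fintype V] {G : SimpleGraph V}

/-- Collapsing a 3-colored set `R` yields a set `A` whose addition to `R` lowers the potential. -/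
lemma exists_extension (hG : MinimalCounterexample G) {R : Finset V} {φ : V → Fin 3}
    (hR : 4 ≤ R.card) (hφ : ∀ a ∈ R, ∀ b ∈ R, G.Adj a b → φ a ≠ φ b) :
    ∃ (A : Finset V) (X : Finset (Fin 3)), A.Nonempty ∧ Disjoint A R ∧ X.Nonempty ∧
      potential G (A ∪ R) + (10 * X.card - 3 * (X.card * (X.card - 1)))
        + 6 * adjCount G A (R.filter fun r => φ r ∉ X) ≤ potential G R + 4 := by
  have hcard : (Rᶜ.disjSum (univ : Finset (Fin 3))).card < Fintype.card V := by
    have := Finset.card_add_card_compl R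
    simp only [Finset.card_disjSum, Finset.card_univ, Fintype.card_fin]
    omega
  obtain ⟨W, hW, hcol, hpot⟩ := hG.exists_of_card_lt _ (collapse G R φ) _ hcard
    (fun h => hG.not_colorable (colorableOn_of_collapse hφ h))
  have hWeq := Finset.toLeft_disjSum_toRight (u := W)
  have hdisj : Disjoint W.toLeft R := by
    refine Finset.disjoint_left.2 fun a ha => ?_
    have := hW (Finset.mem_toLeft.1 ha)
    simpa using this
  refine ⟨W.toLeft, W.toRight, ?_, hdisj, ?_, ?_⟩
  · by_contra hA
    rw [Finset.not_nonempty_iff_eq_empty] at hA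
    refine hcol ⟨Sum.elim (fun _ => 0) id, ?_⟩
    rw [← hWeq, hA]
    simp
  · by_contra hX
    rw [Finset.not_nonempty_iff_eq_empty] at hX
    have hne : W.toLeft ≠ univ := by
      intro h
      obtain ⟨r, hr⟩ : R.Nonempty := Finset.card_pos.1 (by omega)
      exact Finset.disjoint_left.1 hdisj (h ▸ Finset.mem_univ r) hr
    obtain ⟨c, hc⟩ := hG.colorable _ hne
    refine hcol ⟨Sum.elim c (fun _ => 0), ?_⟩
    rw [← hWeq, hX]
    simpa [Finset.mem_disjSum] using hc
  · have h1 := potential_add_le_potential_collapse (G := G) (R := R) (φ := φ) W.toLeft W.toRight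
    rw [hWeq] at h1
    have h2 := adjCount_union_right G W.toLeft
      (Finset.disjoint_filter_filter_not R R fun r => φ r ∈ W.toRight)
    rw [Finset.filter_union_filter_not_eq] at h2
    rw [potential_union G hdisj]
    linarith

lemma ten_lt_potential (hG : MinimalCounterexample G) {R : Finset V} (hR : R ≠ univ)
    (h2 : 2 ≤ R.card) : 10 < potential G R := by
  by_contra! hle
  obtain ⟨S, hS, hmin⟩ := Finset.exists_min_image
    ((univ : Finset (Finset V)).filter fun S => S ≠ univ ∧ 2 ≤ S.card) (potential G)
    ⟨R, by simp [hR, h2]⟩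
  simp only [Finset.mem_filter, Finset.mem_univ, true_and] at hS hmin
  have hSle : potential G S ≤ 10 := (hmin R ⟨hR, h2⟩).trans hle
  have hS4 : 4 ≤ S.card := by
    by_contra! h
    linarith [twelve_le_potential G hS.2 (by omega)]
  obtain ⟨φ, hφ⟩ := hG.colorable S hS.1
  obtain ⟨A, X, hA, hAS, hX, hpot⟩ := hG.exists_extension hS4 hφ
  have hX3 : X.card ≤ 3 := by simpa using Finset.card_le_univ X
  have hX1 : 1 ≤ X.card := hX.card_pos
  have hdrop : potential G (A ∪ S) ≤ potential G S - 6 := by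
    have := adjCount_nonneg G A (S.filter fun r => φ r ∉ X)
    interval_cases X.card <;> norm_num at hpot <;> linarith
  by_cases huniv : A ∪ S = univ
  · have := hG.lt_potential
    rw [← huniv] at this
    linarith
  · have := hmin _ ⟨huniv, hS.2.trans (Finset.card_le_card Finset.subset_union_right)⟩
    linarith

/-- A proper vertex set has at least two vertices with neighbors outside of it. -/
lemma exists_ne_boundary (hG : MinimalCounterexample G) {R : Finset V} (hR : R ≠ univ)
    (h2 : 2 ≤ R.card) :
    ∃ x ∈ R, ∃ y ∈ R, x ≠ y ∧ (∃ s, s ∉ R ∧ G.Adj x s) ∧ ∃ s, s ∉ R ∧ G.Adj y s := by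
  by_contra! hcon
  obtain ⟨x, hx, hxR⟩ : ∃ x ∈ R, ∀ y ∈ R, y ≠ x → ∀ s, s ∉ R → ¬ G.Adj y s := by
    by_cases h : ∃ x ∈ R, ∃ s, s ∉ R ∧ G.Adj x s
    · obtain ⟨x, hx, hs⟩ := h
      exact ⟨x, hx, fun y hy hyx s hsR => hcon x hx y hy hyx.symm hs s hsR⟩
    · push Not at h
      obtain ⟨x, hx⟩ : R.Nonempty := Finset.card_pos.1 (by omega)
      exact ⟨x, hx, fun y hy _ s hs => h y hy s hs⟩
  obtain ⟨φ, hφ⟩ := hG.colorable R hR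
  have hne : insert x Rᶜ ≠ univ := by
    intro h
    have h1 := Finset.card_insert_le x Rᶜ
    rw [h, Finset.card_univ] at h1
    have := Finset.card_add_card_compl R
    omega
  obtain ⟨ψ, hψ⟩ := hG.colorable _ hne
  set σ := Equiv.swap (ψ x) (φ x)
  have hσ : σ (ψ x) = φ x := Equiv.swap_apply_left _ _
  have hcross : ∀ a ∈ R, ∀ b, b ∉ R → G.Adj a b → φ a ≠ σ (ψ b) := by
    intro a ha b hb hab
    by_cases hax : a = x
    · subst hax
      rw [← hσ]
      exact fun h => hψ a (by simp) b (by simp [hb]) hab (σ.injective h)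
    · exact absurd hab (hxR a ha hax b hb)
  refine hG.not_colorable ⟨fun v => if v ∈ R then φ v else σ (ψ v), fun a _ b _ hab => ?_⟩
  by_cases ha : a ∈ R <;> by_cases hb : b ∈ R <;> simp only [ha, hb, if_true, if_false]
  · exact hφ a ha b hb hab
  · exact hcross a ha b hb hab
  · exact (hcross b hb a ha hab.symm).symm
  · exact fun h => hψ a (by simp [ha]) b (by simp [hb]) hab (σ.injective h)

/-- A proper subset of the vertices stays 3-colorable after adding an edge. -/
lemma colorableOn_sup_edge (hG : MinimalCounterexample G) {R : Finset V} (hR : R ≠ univ)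
    (x y : V) : ColorableOn (G ⊔ SimpleGraph.edge x y) R := by
  by_contra hcol
  obtain ⟨W, hW, hWcol, hpot⟩ := hG.exists_of_card_lt _ _ R
    ((Finset.card_lt_iff_ne_univ R).2 hR) hcol
  have := hG.ten_lt_potential (R := W) (fun h => hR (Finset.univ_subset_iff.1 (h ▸ hW)))
    (two_le_card_of_not_colorableOn hWcol)
  linarith [potential_le_potential_sup_edge G x y W]

lemma exists_coloring_ne (hG : MinimalCounterexample G) {R : Finset V} (hR : R ≠ univ)
    {x y : V} (hx : x ∈ R) (hy : y ∈ R) (hxy : x ≠ y) :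
    ∃ φ : V → Fin 3, (∀ a ∈ R, ∀ b ∈ R, G.Adj a b → φ a ≠ φ b) ∧ φ x ≠ φ y := by
  obtain ⟨φ, hφ⟩ := hG.colorableOn_sup_edge hR x y
  refine ⟨φ, fun a ha b hb hab => hφ a ha b hb (Or.inl hab), hφ x hx y hy (Or.inr ?_)⟩
  simp [SimpleGraph.edge_adj, hxy]

lemma twelve_lt_potential (hG : MinimalCounterexample G) {R : Finset V} (hR : R ≠ univ)
    (h4 : 4 ≤ R.card) : 12 < potential G R := by
  by_contra! hle
  obtain ⟨x, hx, y, hy, hxy, ⟨s, hs, hxs⟩, ⟨t, ht, hyt⟩⟩ :=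
    hG.exists_ne_boundary hR (by omega)
  obtain ⟨φ, hφ, hφxy⟩ := hG.exists_coloring_ne hR hx hy hxy
  obtain ⟨A, X, hA, hAR, hX, hpot⟩ := hG.exists_extension h4 hφ
  have hX3 : X.card ≤ 3 := by simpa using Finset.card_le_univ X
  have hX1 : 1 ≤ X.card := hX.card_pos
  have hnonneg := adjCount_nonneg G A (R.filter fun r => φ r ∉ X)
  by_cases huniv : A ∪ R = univ
  · have hmem : ∀ v, v ∉ R → v ∈ A := fun v hv =>
      (Finset.mem_union.1 (huniv ▸ Finset.mem_univ v)).resolve_right hv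
    have hlt := hG.lt_potential
    rw [← huniv] at hlt
    have hcard : X.card = 1 := by
      interval_cases X.card <;> norm_num at hpot ⊢ <;> linarith
    obtain ⟨i, rfl⟩ := Finset.card_eq_one.1 hcard
    have hone : 1 ≤ adjCount G A (R.filter fun r => φ r ∉ ({i} : Finset (Fin 3))) := by
      by_cases hxi : φ x = i
      · exact one_le_adjCount G (hmem t ht)
          (by simpa [hy] using fun h => hφxy (hxi.trans h.symm)) hyt.symm
      · exact one_le_adjCount G (hmem s hs) (by simpa [hx] using hxi) hxs.symm
    norm_num at hpot hone
    linarith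
  · have := hG.ten_lt_potential huniv
      ((by omega : 2 ≤ R.card).trans (Finset.card_le_card Finset.subset_union_right))
    interval_cases X.card <;> norm_num at hpot <;> linarith

lemma exists_adj_color (hG : MinimalCounterexample G) {x : V} {c : V → Fin 3}
    (hc : ∀ a, a ≠ x → ∀ b, b ≠ x → G.Adj a b → c a ≠ c b) (i : Fin 3) :
    ∃ u, G.Adj x u ∧ c u = i := by
  by_contra! hcon
  exact hG.not_colorable ⟨Function.update c x i, fun a _ b _ =>
    update_color_ne (P := fun _ => True) (fun a _ ha b _ hb => hc a ha b hb)
      (fun w _ hw => hcon w hw) a trivial b trivial⟩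

lemma three_le_degree (hG : MinimalCounterexample G) (x : V) : 3 ≤ G.degree x := by
  obtain ⟨c, hc⟩ := hG.colorable (univ.erase x) (by simp)
  have himage : (G.neighborFinset x).image c = univ := by
    ext i
    simpa using hG.exists_adj_color (x := x) (c := c)
      (fun a ha b hb => hc a (by simp [ha]) b (by simp [hb])) i
  have := Finset.card_image_le (s := G.neighborFinset x) (f := c)
  rwa [himage, Finset.card_univ, Fintype.card_fin, SimpleGraph.card_neighborFinset_eq_degree]
    at this

end MinimalCounterexample

section Degree

variable [Fintype V] (G : SimpleGraph V)

lemma adjCount_univ : adjCount G univ univ = ∑ v, (G.degree v : ℤ) := by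
  simp [adjCount, ← SimpleGraph.card_neighborFinset_eq_degree,
    SimpleGraph.neighborFinset_eq_filter]

variable {G}

lemma exists_adj_iff_of_degree_eq_three {x p : V} (hx : G.degree x = 3) (hp : G.Adj x p) :
    ∃ q r, q ≠ p ∧ r ≠ p ∧ q ≠ r ∧ ∀ w, G.Adj x w ↔ w = p ∨ w = q ∨ w = r := by
  rw [← SimpleGraph.card_neighborFinset_eq_degree, Finset.card_eq_three] at hx
  obtain ⟨a, b, c, hab, hac, hbc, h⟩ := hx
  have hadj : ∀ w, G.Adj x w ↔ w = a ∨ w = b ∨ w = c := fun w => by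
    rw [← SimpleGraph.mem_neighborFinset, h]
    simp
  obtain rfl | rfl | rfl := (hadj p).1 hp
  · exact ⟨b, c, hab.symm, hac.symm, hbc, hadj⟩
  · exact ⟨a, c, hab, hbc.symm, hac, fun w => by rw [hadj]; tauto⟩
  · exact ⟨a, b, hac, hbc, hab, fun w => by rw [hadj]; tauto⟩

lemma exists_adj_iff_of_degree_eq_three' {x p q : V} (hx : G.degree x = 3) (hp : G.Adj x p)
    (hq : G.Adj x q) (hpq : p ≠ q) :
    ∃ r, r ≠ p ∧ r ≠ q ∧ ∀ w, G.Adj x w ↔ w = p ∨ w = q ∨ w = r := by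
  obtain ⟨a, b, ha, hb, hab, h⟩ := exists_adj_iff_of_degree_eq_three hx hp
  obtain rfl | rfl | rfl := (h q).1 hq
  · exact absurd rfl hpq
  · exact ⟨b, hb, hab.symm, h⟩
  · exact ⟨a, ha, hab, fun w => by rw [h]; tauto⟩

end Degree

namespace MinimalCounterexample

variable [Fintype V] {G : SimpleGraph V}

lemma five_le_card (hG : MinimalCounterexample G) : 5 ≤ Fintype.card V := by
  have h1 : (∑ _v : V, (3 : ℤ)) ≤ ∑ v, (G.degree v : ℤ) :=
    Finset.sum_le_sum fun v _ => by exact_mod_cast hG.three_le_degree v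
  have h2 := hG.lt_potential
  simp only [potential, adjCount_univ, Finset.card_univ] at h2
  simp only [Finset.sum_const, Finset.card_univ, nsmul_eq_mul] at h1
  have : (4 : ℤ) < Fintype.card V := by linarith
  exact_mod_cast this

/-- There are no two triangles sharing an edge. -/
lemma eq_of_adj (hG : MinimalCounterexample G) {x y a b : V} (hxy : G.Adj x y)
    (hxa : G.Adj x a) (hya : G.Adj y a) (hxb : G.Adj x b) (hyb : G.Adj y b) : a = b := by
  by_contra hab
  have hx : x ∉ ({y, a, b} : Finset V) := by simp [hxy.ne, hxa.ne, hxb.ne]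
  have hy : y ∉ ({a, b} : Finset V) := by simp [hya.ne, hyb.ne]
  have hcard : ({x, y, a, b} : Finset V).card = 4 := by
    rw [Finset.card_insert_of_notMem hx, Finset.card_insert_of_notMem hy, Finset.card_pair hab]
  have hpot := hG.ten_lt_potential (R := {x, y, a, b})
    (fun h => by
      have := hG.five_le_card
      rw [← Finset.card_univ, ← h, hcard] at this
      omega) (by omega)
  have h1 : adjCount G {x} {y, a, b} = 3 := by
    rw [adjCount_singleton, Finset.filter_true_of_mem (by simp [hxy, hxa, hxb]),
      Finset.card_insert_of_notMem hy, Finset.card_pair hab]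
    rfl
  have h2 : adjCount G {y} {a, b} = 2 := by
    rw [adjCount_singleton, Finset.filter_true_of_mem (by simp [hya, hyb]),
      Finset.card_pair hab]
    rfl
  have h3 : potential G {a, b} ≤ 20 := by
    have := adjCount_nonneg G {a, b} {a, b}
    rw [potential, Finset.card_pair hab]
    push_cast
    linarith
  rw [potential_insert G hx, potential_insert G hy] at hpot
  linarith

/-- A triangle has at most one vertex of degree three. -/
lemma not_degree_eq_three_of_triangle (hG : MinimalCounterexample G) {x y z : V}
    (hxy : G.Adj x y) (hxz : G.Adj x z) (hyz : G.Adj y z) (hx : G.degree x = 3)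
    (hy : G.degree y = 3) : False := by
  obtain ⟨a, hay, haz, hxadj⟩ := exists_adj_iff_of_degree_eq_three' hx hxy hxz hyz.ne
  obtain ⟨b, hbx, hbz, hyadj⟩ := exists_adj_iff_of_degree_eq_three' hy hxy.symm hyz hxz.ne
  have hxa : G.Adj x a := (hxadj a).2 (by simp)
  have hyb : G.Adj y b := (hyadj b).2 (by simp)
  have hab : a ≠ b := by
    rintro rfl
    exact haz (hG.eq_of_adj hxy hxa hyb hxz hyz)
  obtain ⟨c, hc, hcab⟩ := hG.exists_coloring_ne (R := {x, y}ᶜ) (x := a) (y := b)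
    (fun h => by simpa using Finset.eq_univ_iff_forall.1 h x)
    (by simp [hxa.ne', hay]) (by simp [hbx, hyb.ne']) hab
  obtain ⟨p, q, hpb, hpz, hqa, hqz, hpq⟩ : ∃ p q, p ≠ c b ∧ p ≠ c z ∧ q ≠ c a ∧ q ≠ c z ∧
      p ≠ q := by
    have : ∀ α β γ : Fin 3, α ≠ β → ∃ p q, p ≠ β ∧ p ≠ γ ∧ q ≠ α ∧ q ≠ γ ∧ p ≠ q := by decide
    exact this _ _ _ hcab
  obtain ⟨u, hxu, hu⟩ := hG.exists_adj_color (x := x) (c := Function.update c y p)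
    (update_color_ne
      (fun v hvx hvy w hwx hwy => hc v (by simp [hvx, hvy]) w (by simp [hwx, hwy]))
      fun w hwx hyw => by
        obtain rfl | rfl | rfl := (hyadj w).1 hyw
        exacts [absurd rfl hwx, hpz.symm, hpb.symm]) q
  obtain rfl | rfl | rfl := (hxadj u).1 hxu
  · exact hpq (by simpa using hu)
  · exact hqz (by simpa [hyz.ne'] using hu.symm)
  · exact hqa (by simpa [hay] using hu.symm)

/-- If two vertices of degree three are adjacent, the other two neighbors of one of them are
adjacent. -/
lemma adj_of_degree_eq_three (hG : MinimalCounterexample G) {x y u v : V}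
    (hxadj : ∀ w, G.Adj x w ↔ w = y ∨ w = u ∨ w = v) (huy : u ≠ y) (hvy : v ≠ y) (huv : u ≠ v)
    (hy : G.degree y = 3) : G.Adj u v := by
  by_contra hnot
  have hxy : G.Adj x y := (hxadj y).2 (by simp)
  have hxu : G.Adj x u := (hxadj u).2 (by simp)
  have hxv : G.Adj x v := (hxadj v).2 (by simp)
  by_cases hcol : ColorableOn (glue G u v) {x, y, v}ᶜ
  · obtain ⟨c, hc⟩ := hcol
    have hu : u ∈ ({x, y, v}ᶜ : Finset V) := by simp [hxu.ne', huy, huv]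
    have hc1 := update_color_ne (G := G) (P := fun w => w ≠ x ∧ w ≠ y) (y := v) (c := c)
      (i := c u)
      (fun a ha hav b hb hbv hab => hc a (by simp [ha, hav]) b (by simp [hb, hbv]) (Or.inl hab))
      (fun w hw hvw => by
        have hwu : w ≠ u := fun h => hnot (h ▸ hvw.symm)
        refine hc w (by simp [hw, hvw.ne']) u hu (Or.inr ?_)
        simp [SimpleGraph.fromRel_adj, hwu, hvw])
    set c1 := Function.update c v (c u)
    obtain ⟨p, q, -, -, -, hyadj⟩ := exists_adj_iff_of_degree_eq_three hy hxy.symm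
    obtain ⟨i, hip, hiq⟩ : ∃ i, c1 p ≠ i ∧ c1 q ≠ i := by
      have : ∀ α β : Fin 3, ∃ i, α ≠ i ∧ β ≠ i := by decide
      exact this _ _
    obtain ⟨j, hji, hju⟩ : ∃ j, i ≠ j ∧ c u ≠ j := by
      have : ∀ α β : Fin 3, ∃ i, α ≠ i ∧ β ≠ i := by decide
      exact this _ _
    obtain ⟨w, hxw, hw⟩ := hG.exists_adj_color (x := x) (c := Function.update c1 y i)
      (update_color_ne (fun a hax hay b hbx hby => hc1 a ⟨hax, hay⟩ b ⟨hbx, hby⟩)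
        fun w hwx hyw => by
          obtain rfl | rfl | rfl := (hyadj w).1 hyw
          exacts [absurd rfl hwx, hip, hiq]) j
    obtain rfl | rfl | rfl := (hxadj w).1 hxw
    · exact hji (by simpa using hw)
    · exact hju (by simpa [c1, huy, huv] using hw)
    · exact hju (by simpa [c1, hvy] using hw)
  · obtain ⟨W, hW, hWcol, hpot⟩ := hG.exists_of_card_lt _ _ _
      ((Finset.card_lt_iff_ne_univ _).2 fun h => by
        simpa using Finset.eq_univ_iff_forall.1 h x) hcol
    have hmem : ∀ w ∈ W, w ≠ x ∧ w ≠ y ∧ w ≠ v := fun w hw => by simpa using hW hw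
    have hvW : v ∉ W := fun h => (hmem v h).2.2 rfl
    have hxW : x ∉ insert v W := by
      simpa [hxv.ne] using fun h => (hmem x h).1 rfl
    have huW : u ∈ W := by
      by_contra huW
      have hne : W ≠ univ := fun h => hxW (by simp [h])
      obtain ⟨c, hc⟩ := hG.colorable W hne
      refine hWcol ⟨c, fun a ha b hb hab => hc a ha b hb ?_⟩
      have hau : a ≠ u := fun h => huW (h ▸ ha)
      have hbu : b ≠ u := fun h => huW (h ▸ hb)
      simpa [glue, SimpleGraph.fromRel_adj, hau, hbu] using hab
    have htwo : 2 ≤ adjCount G {x} (insert v W) := by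
      rw [adjCount_singleton, ← Nat.cast_ofNat, Nat.cast_le, ← Finset.card_pair huv]
      refine Finset.card_le_card fun w hw => ?_
      obtain rfl | rfl : w = u ∨ w = v := by simpa using hw
      · simp [huW, hxu]
      · simp [hxv]
    have hcard : 4 ≤ (insert x (insert v W)).card := by
      rw [Finset.card_insert_of_notMem hxW, Finset.card_insert_of_notMem hvW]
      have := two_le_card_of_not_colorableOn hWcol
      omega
    have hyR : y ∉ insert x (insert v W) := by
      simpa [hxy.ne', hvy.symm] using fun h => (hmem y h).2.1 rfl
    have := hG.twelve_lt_potential (fun h => hyR (by simp [h])) hcard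
    rw [potential_insert G hxW] at this
    linarith [potential_insert_le_potential_glue G huW hvW]

/-- A vertex of degree three has at most one neighbor of degree three. -/
lemma eq_of_adj_of_degree_eq_three (hG : MinimalCounterexample G) {x y z : V}
    (hx : G.degree x = 3) (hy : G.degree y = 3) (hz : G.degree z = 3) (hxy : G.Adj x y)
    (hxz : G.Adj x z) : y = z := by
  by_contra hyz
  obtain ⟨u, huy, huz, hxadj⟩ := exists_adj_iff_of_degree_eq_three' hx hxy hxz hyz
  have hzu := hG.adj_of_degree_eq_three hxadj (Ne.symm hyz) huy huz.symm hy
  exact hG.not_degree_eq_three_of_triangle hxz ((hxadj u).2 (by simp)) hzu hx hz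

/-- There is no minimal counterexample, by discharging from the vertices of degree at least four
to their neighbors of degree three. -/
protected theorem false (hG : MinimalCounterexample G) : False := by
  set m : V → V → ℤ := fun v w => if G.Adj v w ∧ G.degree v = 3 ∧ G.degree w ≠ 3 then 1 else 0
  have hcharge : ∀ v, (20 : ℤ) ≤ 6 * G.degree v + (∑ w, m v w - ∑ w, m w v) := by
    intro v
    have hdeg := hG.three_le_degree v
    by_cases hv : G.degree v = 3
    · have hin : ∑ w, m w v = 0 := Finset.sum_eq_zero fun w _ => by simp [m, hv]
      have hout : 2 ≤ ∑ w, m v w := by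
        have hsplit := Finset.card_filter_add_card_filter_not (s := G.neighborFinset v)
          (fun w => G.degree w = 3)
        have hle : ((G.neighborFinset v).filter fun w => G.degree w = 3).card ≤ 1 := by
          refine Finset.card_le_one.2 fun a ha b hb => ?_
          simp only [Finset.mem_filter, SimpleGraph.mem_neighborFinset] at ha hb
          exact hG.eq_of_adj_of_degree_eq_three hv ha.2 hb.2 ha.1 hb.1
        rw [SimpleGraph.card_neighborFinset_eq_degree, hv] at hsplit
        have hsum : ∑ w, m v w =
            ((G.neighborFinset v).filter fun w => ¬ G.degree w = 3).card := by
          simp [m, hv, SimpleGraph.neighborFinset_eq_filter, Finset.filter_filter]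
        rw [hsum]
        exact_mod_cast (by omega : 2 ≤ _)
      rw [hin, hv]
      push_cast
      linarith
    · have hin : ∑ w, m w v ≤ G.degree v := by
        rw [← SimpleGraph.card_neighborFinset_eq_degree, SimpleGraph.neighborFinset_eq_filter,
          Finset.card_filter]
        push_cast
        refine Finset.sum_le_sum fun w _ => ?_
        by_cases hvw : G.Adj v w
        · simp only [m, hvw, if_true]
          split_ifs <;> simp
        · simp [m, hvw, G.adj_comm w v]
      have hout : 0 ≤ ∑ w, m v w :=
        Finset.sum_nonneg fun w _ => by simp only [m]; split_ifs <;> simp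
      have : (4 : ℤ) ≤ G.degree v := by exact_mod_cast (by omega : 4 ≤ G.degree v)
      linarith
  have hsum := Finset.sum_le_sum fun v (_ : v ∈ (univ : Finset V)) => hcharge v
  rw [Finset.sum_add_distrib, Finset.sum_sub_distrib, Finset.sum_comm (f := m), sub_self,
    ← Finset.mul_sum] at hsum
  simp only [Finset.sum_const, Finset.card_univ, nsmul_eq_mul] at hsum
  have hpot := hG.lt_potential
  simp only [potential, adjCount_univ, Finset.card_univ] at hpot
  linarith

end MinimalCounterexample

lemma colorableOn_map_subtype {G : SimpleGraph V} {T : Finset V} {W : Finset T} :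
    ColorableOn G (W.map (Function.Embedding.subtype _)) ↔
      ColorableOn (G.comap Subtype.val) W := by
  constructor
  · rintro ⟨c, hc⟩
    exact ⟨fun v => c v, fun a ha b hb hab =>
      hc a (by simpa using ha) b (by simpa using hb) hab⟩
  · rintro ⟨c, hc⟩
    refine ⟨fun v => if hv : v ∈ T then c ⟨v, hv⟩ else 0, fun a ha b hb hab => ?_⟩
    simp only [Finset.mem_map, Function.Embedding.subtype_apply] at ha hb
    obtain ⟨a, ha, rfl⟩ := ha
    obtain ⟨b, hb, rfl⟩ := hb
    simpa using hc a ha b hb hab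

lemma potential_map_subtype {G : SimpleGraph V} {T : Finset V} {W : Finset T} :
    potential G (W.map (Function.Embedding.subtype _)) =
      potential (G.comap Subtype.val) W := by
  simp only [potential, adjCount, Finset.sum_map, Finset.card_map,
    Function.Embedding.subtype_apply, SimpleGraph.comap_adj]
  congr!

/-- Every vertex set inducing a non-3-colorable subgraph contains one whose potential is
small. -/
theorem exists_subset_potential_le (n : ℕ) :
    ∀ (V : Type u) (G : SimpleGraph V) (T : Finset V), T.card < n → ¬ ColorableOn G T →
      ∃ W ⊆ T, ¬ ColorableOn G W ∧ potential G W ≤ 4 := by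
  induction n with
  | zero => exact fun V G T hT => absurd hT (Nat.not_lt_zero _)
  | succ n ih =>
    intro V G T hT hcol
    by_cases hproper : ∃ S ⊂ T, ¬ ColorableOn G S
    · obtain ⟨S, hST, hS⟩ := hproper
      obtain ⟨W, hW, h⟩ := ih V G S (by have := Finset.card_lt_card hST; omega) hS
      exact ⟨W, hW.trans hST.subset, h⟩
    push Not at hproper
    refine ⟨T, subset_rfl, hcol, ?_⟩
    have hmap : (univ : Finset T).map (Function.Embedding.subtype _) = T := by
      rw [Finset.univ_eq_attach, Finset.attach_map_val]
    by_contra! hpot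
    refine MinimalCounterexample.false (V := T) (G := G.comap Subtype.val)
      ⟨?_, fun S hS => ?_, ?_, fun U H T' hT' => ih U H T' ?_⟩
    · rwa [← colorableOn_map_subtype, hmap]
    · rw [← colorableOn_map_subtype]
      refine hproper _ ?_
      have := Finset.map_ssubset_map (f := Function.Embedding.subtype (· ∈ T)).2
        (Finset.ssubset_univ_iff.2 hS)
      rwa [hmap] at this
    · rwa [← potential_map_subtype, hmap]
    · rw [Fintype.card_coe] at hT'
      omega

lemma colorableOn_of_induce_colorable {G : SimpleGraph V} {S : Finset V}
    (h : ((⊤ : G.Subgraph).induce S).coe.Colorable 3) : ColorableOn G S := by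
  obtain ⟨c⟩ := h
  refine ⟨fun v => if hv : v ∈ S then c ⟨v, hv⟩ else 0, fun a ha b hb hab => ?_⟩
  simp only [ha, hb, dif_pos]
  exact c.valid (by simpa [SimpleGraph.Subgraph.coe_adj] using ⟨ha, hb, hab⟩)

end FourCritical

open Classical in
/-- Kostochka–Yancey: a 4-critical graph with `n` vertices and `e` edges satisfies
`3e ≥ 5n - 2`. -/
theorem stmt_4 {V : Type*} [Fintype V] (G : SimpleGraph V)
    (h : IsFourCritical G) :
    3 * (G.edgeFinset.card : ℤ) ≥ 5 * (Fintype.card V : ℤ) - 2 := by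
  obtain ⟨hchi, hcrit⟩ := h
  have huniv : ¬ FourCritical.ColorableOn G Finset.univ := by
    rintro ⟨c, hc⟩
    have : G.Colorable 3 :=
      ⟨SimpleGraph.Coloring.mk c fun {a b} hab => hc a (by simp) b (by simp) hab⟩
    have hle := this.chromaticNumber_le
    rw [hchi] at hle
    exact absurd hle (by decide)
  obtain ⟨W, -, hW, hpot⟩ := FourCritical.exists_subset_potential_le _ V G Finset.univ
    (Nat.lt_succ_self _) huniv
  have hWuniv : W = Finset.univ := by
    by_contra hne
    refine hW (FourCritical.colorableOn_of_induce_colorable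
      (SimpleGraph.chromaticNumber_le_iff_colorable.1 (hcrit _ fun htop => hne ?_)))
    have := congrArg SimpleGraph.Subgraph.verts htop
    simpa using this
  subst hWuniv
  have hsum : ∑ v, (G.degree v : ℤ) = 2 * G.edgeFinset.card := by
    exact_mod_cast G.sum_degrees_eq_twice_card_edges
  rw [FourCritical.potential, FourCritical.adjCount_univ, Finset.card_univ] at hpot
  linarith
end

section
/- Let G be a finite simple graph with n vertices and e edges in which every vertex has degree at least 3 and which contains no cycle of length 4. Then three times the number of triangles of G is at most 2e - 2n. -/
open Classical in
/-- In a graph without 4-cycles, two triangles sharing two vertices are equal. -/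
theorem SimpleGraph.eq_of_mem_of_isNClique_three {V : Type*} (G : SimpleGraph V)
    (hC4 : ¬ ∃ a b c d : V, a ≠ b ∧ a ≠ c ∧ a ≠ d ∧ b ≠ c ∧ b ≠ d ∧ c ≠ d ∧
      G.Adj a b ∧ G.Adj b c ∧ G.Adj c d ∧ G.Adj d a)
    {s t : Finset V} (hs : G.IsNClique 3 s) (ht : G.IsNClique 3 t) {v a : V} (hva : v ≠ a)
    (hvs : v ∈ s) (hvt : v ∈ t) (has : a ∈ s) (hat : a ∈ t) : s = t := by
  have third {r : Finset V} (hr : G.IsNClique 3 r) (hv : v ∈ r) (ha : a ∈ r) :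
      ∃ b, G.Adj v b ∧ G.Adj a b ∧ r = {v, a, b} := by
    have hcard : ((r.erase v).erase a).card = 1 := by
      rw [Finset.card_erase_of_mem (by simp [ha, hva.symm]), Finset.card_erase_of_mem hv,
        hr.card_eq]
    obtain ⟨b, hb⟩ := Finset.card_eq_one.mp hcard
    have hbr : b ∈ (r.erase v).erase a := by simp [hb]
    simp only [Finset.mem_erase] at hbr
    obtain ⟨hba, hbv, hbr⟩ := hbr
    refine ⟨b, hr.isClique hv hbr hbv.symm, hr.isClique ha hbr hba.symm, ?_⟩
    rw [← hb, Finset.insert_erase (by simp [ha, hva.symm]), Finset.insert_erase hv]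
  obtain ⟨b, hvb, hab, rfl⟩ := third hs hvs has
  obtain ⟨c, hvc, hac, rfl⟩ := third ht hvt hat
  by_contra hne
  have hbc : b ≠ c := by
    rintro rfl
    exact hne rfl
  exact hC4 ⟨v, b, a, c, hvb.ne, hva, hvc.ne, hab.ne.symm, hbc, hac.ne,
    hvb, hab.symm, hac, hvc.symm⟩

open Classical in
/-- In a graph without 4-cycles, a vertex lies in at most half as many triangles as its degree. -/
theorem SimpleGraph.two_mul_card_triangles_le_degree {V : Type*} [Fintype V] (G : SimpleGraph V)
    (hC4 : ¬ ∃ a b c d : V, a ≠ b ∧ a ≠ c ∧ a ≠ d ∧ b ≠ c ∧ b ≠ d ∧ c ≠ d ∧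
      G.Adj a b ∧ G.Adj b c ∧ G.Adj c d ∧ G.Adj d a) (v : V) :
    2 * ((G.cliqueFinset 3).filter (v ∈ ·)).card ≤ G.degree v := by
  set T := (G.cliqueFinset 3).filter (v ∈ ·) with hT
  have hmem {s : Finset V} : s ∈ T ↔ G.IsNClique 3 s ∧ v ∈ s := by
    simp [hT, SimpleGraph.mem_cliqueFinset_iff]
  have hdisj : (T : Set (Finset V)).PairwiseDisjoint (fun s => s.erase v) := by
    intro s hs t ht hst
    obtain ⟨hs, hvs⟩ := hmem.mp hs
    obtain ⟨ht, hvt⟩ := hmem.mp ht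
    refine Finset.disjoint_left.mpr fun a has hat => hst ?_
    rw [Finset.mem_erase] at has hat
    exact G.eq_of_mem_of_isNClique_three hC4 hs ht has.1.symm hvs hvt has.2 hat.2
  have hcard : (T.biUnion fun s => s.erase v).card = 2 * T.card := by
    rw [Finset.card_biUnion hdisj, Finset.sum_const_nat (m := 2), mul_comm]
    intro s hs
    rw [Finset.card_erase_of_mem (hmem.mp hs).2, (hmem.mp hs).1.card_eq]
  rw [← hcard, ← G.card_neighborFinset_eq_degree]
  refine Finset.card_le_card (Finset.biUnion_subset.mpr fun s hs a ha => ?_)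
  rw [Finset.mem_erase] at ha
  rw [SimpleGraph.mem_neighborFinset]
  exact (hmem.mp hs).1.isClique (hmem.mp hs).2 ha.2 ha.1.symm

open Classical in
/-- In a finite simple graph with `n` vertices and `e` edges, of minimum degree at least 3
and with no cycle of length 4, three times the number of triangles is at most `2e - 2n`. -/
theorem stmt_8 {V : Type*} [Fintype V] (G : SimpleGraph V)
    (hdeg : ∀ v : V, 3 ≤ G.degree v)
    (hC4 : ¬ ∃ a b c d : V, a ≠ b ∧ a ≠ c ∧ a ≠ d ∧ b ≠ c ∧ b ≠ d ∧ c ≠ d ∧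
      G.Adj a b ∧ G.Adj b c ∧ G.Adj c d ∧ G.Adj d a) :
    3 * ((G.cliqueFinset 3).card : ℤ) ≤
      2 * (G.edgeFinset.card : ℤ) - 2 * (Fintype.card V : ℤ) := by
  have hcount : ∑ v : V, ((G.cliqueFinset 3).filter (v ∈ ·)).card =
      3 * (G.cliqueFinset 3).card := by
    have h := Finset.sum_card_bipartiteAbove_eq_sum_card_bipartiteBelow
      (s := (Finset.univ : Finset V)) (t := G.cliqueFinset 3) (fun v s => v ∈ s)
    simp only [Finset.bipartiteAbove, Finset.bipartiteBelow] at h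
    rw [h, Finset.sum_const_nat (m := 3), mul_comm]
    intro s hs
    simpa using (SimpleGraph.mem_cliqueFinset_iff.mp hs).card_eq
  have hle : ∑ v : V, (((G.cliqueFinset 3).filter (v ∈ ·)).card + 2) ≤ ∑ v : V, G.degree v := by
    refine Finset.sum_le_sum fun v _ => ?_
    have h2 := G.two_mul_card_triangles_le_degree hC4 v
    have h3 := hdeg v
    omega
  rw [Finset.sum_add_distrib, hcount, G.sum_degrees_eq_twice_card_edges] at hle
  simp only [Finset.sum_const, Finset.card_univ, smul_eq_mul] at hle
  omega
end
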